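/- arXiv:2511.06347 — 2 statements merged into one kernel-verified Lean document; each statement's English description precedes it below -/
import Mathlib

section
/- Assume the characteristic of 𝔽_q is exactly 3 (so q is a power of 3). Then the set {(r,s) ∈ 𝔽_q × 𝔽_q : r ≠ s, s² − s + (d + e − 4de) ≠ 0, and H(r,s) = 0} has exactly q − 3 elements, where H(r,s) = (1−4d)(1−4e)·r² + [−4s³ + 6s² + (−16de + 4d + 4e − 4)s + (−8de + 2d + 2e)]·r + [s⁴ + (24de − 6d − 6e)s² + (−16de + 4d + 4e)s + (−48d²e² + 24d²e + 24de² − 3d² − 6de − 3e²)]. -/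
open Polynomial

theorem not_isSquare_one_sub_of_irreducible {F : Type*} [Field F] (h3 : (3 : F) = 0) (d : F)
    (hd : Irreducible (X ^ 2 + X + C d : F[X])) : ¬ IsSquare (1 - d) := by
  rintro ⟨a, ha⟩
  have hroot : IsRoot (X ^ 2 + X + C d : F[X]) (1 + a) := by
    simp only [IsRoot, eval_add, eval_pow, eval_X, eval_C]
    linear_combination (1 + a) * h3 - ha
  have hdeg := degree_eq_one_of_irreducible_of_root hd hroot
  have : (X ^ 2 + X + C d : F[X]).degree = 2 := by compute_degree!
  rw [this] at hdeg
  exact absurd hdeg (by decide)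

theorem isSquare_mul_of_not_isSquare {F : Type*} [Field F] [Fintype F] {a b : F}
    (ha : ¬ IsSquare a) (hb : ¬ IsSquare b) : IsSquare (a * b) := by
  classical
  by_cases h2 : ringChar F = 2
  · exact FiniteField.isSquare_of_char_two h2 _
  have hab : a * b ≠ 0 := by
    refine mul_ne_zero ?_ ?_
    · rintro rfl; exact ha IsSquare.zero
    · rintro rfl; exact hb IsSquare.zero
  rw [← quadraticChar_one_iff_isSquare hab, map_mul,
    quadraticChar_neg_one_iff_not_isSquare.mpr ha, quadraticChar_neg_one_iff_not_isSquare.mpr hb]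
  norm_num

/-- char = 3; `T² + T + d` and `T² + T + e` irreducible. The set of pairs
`(r,s)` with `r ≠ s`, `s² − s + (d + e − 4de) ≠ 0` and `H(r,s) = 0` (the Cayley coefficient
`H₂` for the pencil `𝒫₁₆`) has exactly `q − 3` elements. -/
theorem stmt6 {F : Type*} [Field F] [Fintype F]
    (h2 : ringChar F ≠ 2) (h3 : ringChar F = 3) (d e : F)
    (hd : Irreducible (X ^ 2 + X + C d : F[X]))
    (he : Irreducible (X ^ 2 + X + C e : F[X])) :
    {p : F × F | p.1 ≠ p.2 ∧ p.2 ^ 2 - p.2 + (d + e - 4 * d * e) ≠ 0 ∧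
      (1 - 4 * d) * (1 - 4 * e) * p.1 ^ 2 +
        (-4 * p.2 ^ 3 + 6 * p.2 ^ 2 + (-16 * d * e + 4 * d + 4 * e - 4) * p.2 +
          (-8 * d * e + 2 * d + 2 * e)) * p.1 +
        (p.2 ^ 4 + (24 * d * e - 6 * d - 6 * e) * p.2 ^ 2 +
          (-16 * d * e + 4 * d + 4 * e) * p.2 +
          (-48 * d ^ 2 * e ^ 2 + 24 * d ^ 2 * e + 24 * d * e ^ 2 - 3 * d ^ 2 -
            6 * d * e - 3 * e ^ 2)) = 0}.ncard =
      Fintype.card F - 3 := by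
  classical
  have h30 : (3 : F) = 0 := by
    have := ringChar.Nat.cast_ringChar (R := F)
    rw [h3] at this
    exact_mod_cast this
  have h20 : (2 : F) ≠ 0 := Ring.two_ne_zero h2
  have hd' := not_isSquare_one_sub_of_irreducible h30 d hd
  have he' := not_isSquare_one_sub_of_irreducible h30 e he
  obtain ⟨m, hm⟩ := isSquare_mul_of_not_isSquare hd' he'
  have hm0 : m ≠ 0 := by
    rintro rfl
    rw [mul_zero, mul_eq_zero] at hm
    rcases hm with h | h
    · exact hd' (h ▸ IsSquare.zero)
    · exact he' (h ▸ IsSquare.zero)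
  have hmm : m ^ 2 ≠ 0 := pow_ne_zero 2 hm0
  let S : Finset F := {-1, -1 + m, -1 - m}
  have hS : S.card = 3 := by
    refine Finset.card_eq_three.mpr ⟨-1, -1 + m, -1 - m, ?_, ?_, ?_, rfl⟩
    · intro h; exact hm0 (by linear_combination -h)
    · intro h; exact hm0 (by linear_combination h)
    · intro h
      exact mul_ne_zero h20 hm0 (by linear_combination h)
  have key : ∀ r s : F,
      (1 - 4 * d) * (1 - 4 * e) * r ^ 2 +
        (-4 * s ^ 3 + 6 * s ^ 2 + (-16 * d * e + 4 * d + 4 * e - 4) * s +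
          (-8 * d * e + 2 * d + 2 * e)) * r +
        (s ^ 4 + (24 * d * e - 6 * d - 6 * e) * s ^ 2 +
          (-16 * d * e + 4 * d + 4 * e) * s +
          (-48 * d ^ 2 * e ^ 2 + 24 * d ^ 2 * e + 24 * d * e ^ 2 - 3 * d ^ 2 -
            6 * d * e - 3 * e ^ 2)) =
      (r - s) * (m ^ 2 * (r + 1) - (s + 1) ^ 3) := by
    intro r s
    linear_combination (r - s) * (r + 1) * hm +
      ((-d - e + 5 * d * e) * r ^ 2 - r * s ^ 3 + 3 * r * s ^ 2 + (d + e - 5 * d * e) * r * s +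
        (d + e - 3 * d * e) * r - s ^ 3 + (8 * d * e - 2 * d - 2 * e - 1) * s ^ 2 +
        (d + e - 5 * d * e) * s + (-16 * d ^ 2 * e ^ 2 + 8 * d ^ 2 * e + 8 * d * e ^ 2 - d ^ 2 -
        2 * d * e - e ^ 2)) * h30
  have hsmooth : ∀ s : F, s ^ 2 - s + (d + e - 4 * d * e) = (s + 1) ^ 2 - m ^ 2 := by
    intro s
    linear_combination (-s - d * e) * h30 - hm
  have hset : ∀ s : F, s ∈ Sᶜ ↔ s + 1 ≠ 0 ∧ (s + 1) ^ 2 ≠ m ^ 2 := by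
    intro s
    rw [ne_eq, ne_eq, sq_eq_sq_iff_eq_or_eq_neg]
    simp only [S, Finset.mem_compl, Finset.mem_insert, Finset.mem_singleton, not_or]
    grind
  calc _ = ((fun s : F => ((s + 1) ^ 3 / m ^ 2 - 1, s)) '' (↑Sᶜ : Set F)).ncard := by
        congr 1
        ext ⟨r, s⟩
        simp only [Set.mem_ofPred_eq, Set.mem_image, Finset.mem_coe, Prod.mk.injEq, key, hsmooth,
          hset, mul_eq_zero, sub_eq_zero, sub_ne_zero]
        constructor
        · rintro ⟨hrs, hs, h⟩
          have h := h.resolve_left hrs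
          refine ⟨s, ⟨fun h0 => hrs ?_, hs⟩, ?_, rfl⟩
          · have hr : m ^ 2 * (r + 1) = 0 := by rw [h, h0]; ring
            have := (mul_eq_zero.mp hr).resolve_left hmm
            linear_combination this - h0
          · rw [← h]; field_simp; ring
        · rintro ⟨s, ⟨h0, hs⟩, rfl, rfl⟩
          refine ⟨fun h => ?_, hs, Or.inr (by field_simp; ring)⟩
          apply hs
          apply mul_right_cancel₀ h0
          have h' : (s + 1) ^ 3 / m ^ 2 = s + 1 := by linear_combination h
          rw [div_eq_iff hmm] at h'
          linear_combination h'
    _ = _ := by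
        rw [Set.ncard_image_of_injective _ fun a b h => (Prod.mk.inj h).2,
          Set.ncard_coe_finset, Finset.card_compl, hS]
end

section
/- For all r, s ∈ 𝔽_q, (1 − 4e)·r² + (8es − 2s)·r + (−e²s⁴ + 2es³ − 6es² + 2s − 1) ≠ 0. (Indeed, regarded as a quadratic in r, this polynomial has discriminant 4(1 − 4e)(es² − s + 1)², which is a non-square in 𝔽_q for every s ∈ 𝔽_q.) -/
open Polynomial

theorem sq_add_self_add_ne_zero_of_irreducible {F : Type*} [Field F] {e : F}
    (he : Irreducible (X ^ 2 + X + C e : F[X])) (t : F) : t ^ 2 + t + e ≠ 0 := by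
  intro ht
  have hdeg : (X ^ 2 + X + C e : F[X]).degree = 2 := by compute_degree!
  have hroot : (X ^ 2 + X + C e : F[X]).IsRoot t := by simpa [IsRoot] using ht
  have := degree_eq_one_of_irreducible_of_root he hroot
  rw [hdeg] at this
  exact absurd this (by decide)

/-- `T² + T + e` irreducible. The quadratic factor of `H₃` for the pencil `𝒫₁₄`
never vanishes: for all `r, s ∈ 𝔽_q`,
`(1 − 4e)r² + (8es − 2s)r + (−e²s⁴ + 2es³ − 6es² + 2s − 1) ≠ 0`. -/
theorem stmt16 {F : Type*} [Field F] [Fintype F]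
    (h2 : ringChar F ≠ 2) (e : F)
    (he : Irreducible (X ^ 2 + X + C e : F[X])) :
    ∀ r s : F,
      (1 - 4 * e) * r ^ 2 + (8 * e * s - 2 * s) * r +
        (-e ^ 2 * s ^ 4 + 2 * e * s ^ 3 - 6 * e * s ^ 2 + 2 * s - 1) ≠ 0 := by
  intro r s h
  have two_ne : (2 : F) ≠ 0 := Ring.two_ne_zero h2
  have no_root := sq_add_self_add_ne_zero_of_irreducible he
  have hsq : (1 - 4 * e) * (r - s) ^ 2 = (e * s ^ 2 - s + 1) ^ 2 := by
    linear_combination h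
  rcases eq_or_ne r s with rfl | hrs
  · have hw : e * r ^ 2 - r + 1 = 0 := by
      rw [sub_self, zero_pow two_ne_zero, mul_zero] at hsq
      exact pow_eq_zero_iff two_ne_zero |>.mp hsq.symm
    have hr : r ≠ 0 := by
      rintro rfl
      simp at hw
    apply no_root (-1 / r)
    field_simp
    linear_combination hw
  · have hd : r - s ≠ 0 := sub_ne_zero.mpr hrs
    apply no_root (((e * s ^ 2 - s + 1) / (r - s) - 1) / 2)
    have hD : ((e * s ^ 2 - s + 1) / (r - s)) ^ 2 = 1 - 4 * e := by
      rw [div_pow, ← hsq, mul_div_cancel_right₀ _ (pow_ne_zero 2 hd)]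
    generalize (e * s ^ 2 - s + 1) / (r - s) = d at hD
    field_simp
    linear_combination hD
end
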